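/- Let x : U → ℝ³ be a proper wavefront, Ω a tmb of x, and p ∈ Σ(x) with rank(Dx(p)) = 0. Then the following are equivalent: (1) x is parallelly smoothable at p; (2) λ_Ω·K_Ω ≥ 0 on some neighborhood V of p and H_Ω does not change sign on V; (3) K(u,v) → +∞ and H(u,v) tends to +∞ or tends to −∞ as (u,v) → p through Σ(x)ᶜ; (4) as (u,v) → p through Σ(x)ᶜ, either k₁ → +∞ and k₂ → +∞, or k₁ → −∞ and k₂ → −∞. -/

import Mathlib

/- Common framework for frontals and tangent moving bases, following
   "Curvatures on fronts" conventions. -/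

noncomputable section

open Matrix Topology Filter

/-- Points of the plane ℝ². -/
abbrev Pt : Type := Fin 2 → ℝ

/-- Jacobian matrix of a map `f : ℝ² → ℝ^m` at a point. -/
def jac {m : ℕ} (f : Pt → (Fin m → ℝ)) (p : Pt) : Matrix (Fin m) (Fin 2) ℝ :=
  Matrix.of fun i j => fderiv ℝ f p (Pi.single j 1) i

/-- Euclidean norm of a vector in ℝ³. -/
def enorm3 (v : Fin 3 → ℝ) : ℝ := Real.sqrt (v ⬝ᵥ v)

/-- The unit normal vector field induced by a tangent moving base `Ω`,
    `n := (w₁ × w₂)/‖w₁ × w₂‖` where `w₁, w₂` are the columns of `Ω`. -/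
def normalOf (Ω : Pt → Matrix (Fin 3) (Fin 2) ℝ) (p : Pt) : Fin 3 → ℝ :=
  (enorm3 (crossProduct (fun i => Ω p i 0) (fun i => Ω p i 1)))⁻¹ •
    crossProduct (fun i => Ω p i 0) (fun i => Ω p i 1)

/-- First fundamental form matrix of a map `y`. -/
def IOf (y : Pt → Fin 3 → ℝ) (p : Pt) : Matrix (Fin 2) (Fin 2) ℝ :=
  (jac y p)ᵀ * jac y p

/-- Second fundamental form matrix of a map `y` with respect to a unit normal `ν`. -/
def IIOf (y ν : Pt → Fin 3 → ℝ) (p : Pt) : Matrix (Fin 2) (Fin 2) ℝ :=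
  -((jac y p)ᵀ * jac ν p)

/-- Weingarten matrix `α := −IIᵀ I⁻¹` of a map `y` with unit normal `ν`. -/
def weinOf (y ν : Pt → Fin 3 → ℝ) (p : Pt) : Matrix (Fin 2) (Fin 2) ℝ :=
  -((IIOf y ν p)ᵀ * (IOf y p)⁻¹)

/-- Gaussian curvature of an immersion `y` with unit normal `ν`. -/
def KgOf (y ν : Pt → Fin 3 → ℝ) (p : Pt) : ℝ :=
  (IIOf y ν p).det / (IOf y p).det

/-- Mean curvature of an immersion `y` with unit normal `ν`. -/
def HmOf (y ν : Pt → Fin 3 → ℝ) (p : Pt) : ℝ :=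
  -(1 / 2) * (weinOf y ν p).trace

/-- Smaller principal curvature `H − √(H² − K)` of an immersion `y`. -/
def k1Of (y ν : Pt → Fin 3 → ℝ) (p : Pt) : ℝ :=
  HmOf y ν p - Real.sqrt ((HmOf y ν p) ^ 2 - KgOf y ν p)

/-- Larger principal curvature `H + √(H² − K)` of an immersion `y`. -/
def k2Of (y ν : Pt → Fin 3 → ℝ) (p : Pt) : ℝ :=
  HmOf y ν p + Real.sqrt ((HmOf y ν p) ^ 2 - KgOf y ν p)

/-- A frontal `x : U → ℝ³` equipped with a tangent moving base (tmb) `Ω` and the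
induced smooth matrix-valued maps `Λ`, `μ` satisfying `Dx = Ω Λᵀ` and `Dn = Ω μᵀ` on `U`. -/
structure Frontal where
  /-- the domain -/
  U : Set Pt
  isOpen_U : IsOpen U
  /-- the frontal -/
  x : Pt → Fin 3 → ℝ
  /-- the tangent moving base -/
  Ω : Pt → Matrix (Fin 3) (Fin 2) ℝ
  /-- `Λ` with `Dx = Ω Λᵀ` -/
  Λ : Pt → Matrix (Fin 2) (Fin 2) ℝ
  /-- `μ` with `Dn = Ω μᵀ` -/
  μ : Pt → Matrix (Fin 2) (Fin 2) ℝ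
  smooth_x : ContDiffOn ℝ (⊤ : ℕ∞) x U
  smooth_Ω : ∀ i j, ContDiffOn ℝ (⊤ : ℕ∞) (fun p => Ω p i j) U
  smooth_Λ : ∀ i j, ContDiffOn ℝ (⊤ : ℕ∞) (fun p => Λ p i j) U
  smooth_μ : ∀ i j, ContDiffOn ℝ (⊤ : ℕ∞) (fun p => μ p i j) U
  /-- the columns of `Ω` are linearly independent (nonzero cross product) -/
  indep : ∀ p ∈ U, crossProduct (fun i => Ω p i 0) (fun i => Ω p i 1) ≠ 0
  decomp_x : ∀ p ∈ U, jac x p = Ω p * (Λ p)ᵀ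
  decomp_n : ∀ p ∈ U, jac (normalOf Ω) p = Ω p * (μ p)ᵀ

namespace Frontal

variable (F : Frontal)

/-- The unit normal induced by the tmb. -/
def n : Pt → Fin 3 → ℝ := normalOf F.Ω

/-- `λ_Ω := det Λ`. -/
def lam (p : Pt) : ℝ := (F.Λ p).det

/-- The Ω-relative curvature `K_Ω := det μ`. -/
def KΩ (p : Pt) : ℝ := (F.μ p).det

/-- `α_Ω := μ · adj(Λ)`. -/
def αΩ (p : Pt) : Matrix (Fin 2) (Fin 2) ℝ := F.μ p * (F.Λ p).adjugate

/-- The Ω-relative mean curvature `H_Ω := −(1/2) tr α_Ω`. -/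
def HΩ (p : Pt) : ℝ := -(1 / 2) * (F.αΩ p).trace

/-- The relative principal curvature `k_{1Ω} := H_Ω − √(H_Ω² − λ_Ω K_Ω)`. -/
def k1Ω (p : Pt) : ℝ := F.HΩ p - Real.sqrt ((F.HΩ p) ^ 2 - F.lam p * F.KΩ p)

/-- The relative principal curvature `k_{2Ω} := H_Ω + √(H_Ω² − λ_Ω K_Ω)`. -/
def k2Ω (p : Pt) : ℝ := F.HΩ p + Real.sqrt ((F.HΩ p) ^ 2 - F.lam p * F.KΩ p)

/-- The singular set `Σ(x) = λ_Ω⁻¹(0)`. -/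
def sing : Set Pt := {p ∈ F.U | F.lam p = 0}

/-- The regular set `U − Σ(x)`. -/
def reg : Set Pt := {p ∈ F.U | F.lam p ≠ 0}

/-- A frontal is proper if its singular set has empty interior. -/
def IsProper : Prop := interior F.sing = ∅

/-- `x` is a wavefront if `(x, n) : U → ℝ³ × S²` is an immersion. -/
def IsWavefront : Prop :=
  ∀ p ∈ F.U, (Matrix.fromRows (jac F.x p) (jac F.n p)).rank = 2

/-- First fundamental form matrix `I = Dxᵀ Dx`. -/
def Imat (p : Pt) : Matrix (Fin 2) (Fin 2) ℝ := IOf F.x p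

/-- Second fundamental form matrix `II = −Dxᵀ Dn`. -/
def IImat (p : Pt) : Matrix (Fin 2) (Fin 2) ℝ := IIOf F.x F.n p

/-- Weingarten matrix `α := −IIᵀ I⁻¹` (meaningful off the singular set). -/
def Wein (p : Pt) : Matrix (Fin 2) (Fin 2) ℝ := weinOf F.x F.n p

/-- Coefficient `e` of the second fundamental form. -/
def e (p : Pt) : ℝ := F.IImat p 0 0

/-- Coefficient `f` of the second fundamental form. -/
def f (p : Pt) : ℝ := F.IImat p 0 1

/-- Coefficient `g` of the second fundamental form. -/
def g (p : Pt) : ℝ := F.IImat p 1 1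

/-- Gaussian curvature (meaningful off the singular set). -/
def Kg (p : Pt) : ℝ := KgOf F.x F.n p

/-- Mean curvature (meaningful off the singular set). -/
def Hm (p : Pt) : ℝ := HmOf F.x F.n p

/-- Principal curvature `κ₋ := H − √(H² − K)`. -/
def κm (p : Pt) : ℝ := F.Hm p - Real.sqrt ((F.Hm p) ^ 2 - F.Kg p)

/-- Principal curvature `κ₊ := H + √(H² − K)`. -/
def κp (p : Pt) : ℝ := F.Hm p + Real.sqrt ((F.Hm p) ^ 2 - F.Kg p)

/-- `k₁ := κ₋` where `λ_Ω > 0` and `k₁ := κ₊` where `λ_Ω < 0`. -/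
def k1 (p : Pt) : ℝ := if 0 < F.lam p then F.κm p else F.κp p

/-- `k₂ := κ₊` where `λ_Ω > 0` and `k₂ := κ₋` where `λ_Ω < 0`. -/
def k2 (p : Pt) : ℝ := if 0 < F.lam p then F.κp p else F.κm p

/-- `x` is parallelly smoothable at `p` : for some `ε > 0` and some open
neighborhood `V` of `p`, `rank D(x + l·n)(q) = 2` for all `(q,l) ∈ V × (0,ε)`
or for all `(q,l) ∈ V × (−ε,0)`. -/
def ParSmoothable (p : Pt) : Prop :=
  ∃ ε > (0 : ℝ), ∃ V : Set Pt, IsOpen V ∧ p ∈ V ∧ V ⊆ F.U ∧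
    ((∀ q ∈ V, ∀ l ∈ Set.Ioo (0 : ℝ) ε,
        (jac (fun z => F.x z + l • F.n z) q).rank = 2) ∨
     (∀ q ∈ V, ∀ l ∈ Set.Ioo (-ε) (0 : ℝ),
        (jac (fun z => F.x z + l • F.n z) q).rank = 2))

/-- `f` (defined off the singular set) has a `C^∞` extension to `V`. -/
def SmoothExtOn (f : Pt → ℝ) (V : Set Pt) : Prop :=
  ∃ g : Pt → ℝ, ContDiffOn ℝ (⊤ : ℕ∞) g V ∧ ∀ q ∈ V ∩ F.reg, g q = f q

/-- `f` has a `C^∞` extension to some open neighborhood of `p`. -/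
def SmoothExtNear (f : Pt → ℝ) (p : Pt) : Prop :=
  ∃ V : Set Pt, IsOpen V ∧ p ∈ V ∧ V ⊆ F.U ∧ F.SmoothExtOn f V

/-- Membership in the principal ideal `𝔗_Ω(V)` generated by `λ_Ω` in `C^∞(V,ℝ)`. -/
def memIdeal (f : Pt → ℝ) (V : Set Pt) : Prop :=
  ∃ φ : Pt → ℝ, ContDiffOn ℝ (⊤ : ℕ∞) φ V ∧ ∀ q ∈ V, f q = φ q * F.lam q

end Frontal

/-- `f` does not change sign on `V`. -/
def NoSignChange (f : Pt → ℝ) (V : Set Pt) : Prop :=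
  (∀ q ∈ V, 0 ≤ f q) ∨ (∀ q ∈ V, f q ≤ 0)

lemma differentiableAt_crossProduct {a b : Pt → Fin 3 → ℝ} {q : Pt}
    (ha : ∀ i, DifferentiableAt ℝ (fun z => a z i) q)
    (hb : ∀ i, DifferentiableAt ℝ (fun z => b z i) q) :
    DifferentiableAt ℝ (fun z => crossProduct (a z) (b z)) q := by
  have ha0 := ha 0
  have ha1 := ha 1
  have ha2 := ha 2
  have hb0 := hb 0
  have hb1 := hb 1
  have hb2 := hb 2
  rw [differentiableAt_pi]
  intro i
  fin_cases i <;> simp [cross_apply] <;> fun_prop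

lemma sq_nonneg_discriminant {E F G e f g : ℝ} (hE : 0 < E) (hd : 0 < E * G - F ^ 2) :
    4 * (e * g - f ^ 2) * (E * G - F ^ 2) ≤ (e * G - 2 * f * F + g * E) ^ 2 := by
  have key : (e * G - 2 * f * F + g * E) ^ 2 - 4 * (e * g - f ^ 2) * (E * G - F ^ 2) =
      4 * ((E * G - F ^ 2) / E ^ 2) * (E * f - F * e) ^ 2 +
        (E * g - G * e - (2 * F / E) * (E * f - F * e)) ^ 2 := by
    field_simp
    ring
  have : 0 ≤ 4 * ((E * G - F ^ 2) / E ^ 2) * (E * f - F * e) ^ 2 := by positivity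
  nlinarith [sq_nonneg (E * g - G * e - (2 * F / E) * (E * f - F * e))]

lemma rank_eq_two_iff_det_gram_ne_zero {m : Type*} [Fintype m] (M : Matrix m (Fin 2) ℝ) :
    M.rank = 2 ↔ (Mᵀ * M).det ≠ 0 := by
  rw [← rank_transpose_mul_self, ← isUnit_iff_ne_zero, ← isUnit_iff_isUnit_det]
  refine ⟨fun h => mulVec_surjective_iff_isUnit.1 ?_, fun h => by
    simpa using rank_of_isUnit _ h⟩
  have htop : (Mᵀ * M).mulVecLin.range = ⊤ :=
    Submodule.eq_top_of_finrank_eq (h.trans (Module.finrank_fin_fun ℝ).symm)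
  exact LinearMap.range_eq_top.1 htop

lemma eq_zero_of_rank_eq_zero {m : Type*} [Finite m] {M : Matrix m (Fin 2) ℝ} (h : M.rank = 0) :
    M = 0 := by
  have h1 : M.mulVecLin.range = ⊥ := Submodule.finrank_eq_zero.1 h
  have h2 : M.mulVecLin = 0 := LinearMap.range_eq_bot.1 h1
  ext i j
  simpa using congrFun (LinearMap.congr_fun h2 (Pi.single j 1)) i

namespace Frontal

variable (F : Frontal) {q : Pt}

lemma det_gram_pos (hq : q ∈ F.U) : 0 < ((F.Ω q)ᵀ * F.Ω q).det := by
  have h := F.indep q hq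
  have h2 : ((F.Ω q)ᵀ * F.Ω q).det =
      crossProduct (fun i => F.Ω q i 0) (fun i => F.Ω q i 1) ⬝ᵥ
        crossProduct (fun i => F.Ω q i 0) (fun i => F.Ω q i 1) := by
    simp [det_fin_two, Matrix.mul_apply, cross_apply, Fin.sum_univ_three, dotProduct]
    ring
  rw [h2]
  refine lt_of_le_of_ne ?_ (fun h0 => h (dotProduct_self_eq_zero.1 h0.symm))
  exact Finset.sum_nonneg fun i _ => mul_self_nonneg _

lemma rank_base_mul_transpose (hq : q ∈ F.U) (A : Matrix (Fin 2) (Fin 2) ℝ) :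
    (F.Ω q * Aᵀ).rank = 2 ↔ A.det ≠ 0 := by
  have h : (F.Ω q * Aᵀ)ᵀ * (F.Ω q * Aᵀ) = A * ((F.Ω q)ᵀ * F.Ω q) * Aᵀ := by
    simp only [transpose_mul, transpose_transpose, Matrix.mul_assoc]
  rw [rank_eq_two_iff_det_gram_ne_zero, h, det_mul, det_mul, det_transpose]
  simp [(F.det_gram_pos hq).ne']

lemma contDiffAt_x (hq : q ∈ F.U) : ContDiffAt ℝ (⊤ : ℕ∞) F.x q :=
  F.smooth_x.contDiffAt (F.isOpen_U.mem_nhds hq)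

lemma differentiableAt_n (hq : q ∈ F.U) : DifferentiableAt ℝ F.n q := by
  have hΩ : ∀ i j, DifferentiableAt ℝ (fun z => F.Ω z i j) q := fun i j =>
    ((F.smooth_Ω i j).contDiffAt (F.isOpen_U.mem_nhds hq)).differentiableAt (by simp)
  have hc := differentiableAt_crossProduct (fun i => hΩ i 0) (fun i => hΩ i 1)
  have hne : crossProduct (fun i => F.Ω q i 0) (fun i => F.Ω q i 1) ⬝ᵥ
      crossProduct (fun i => F.Ω q i 0) (fun i => F.Ω q i 1) ≠ 0 :=
    fun h => F.indep q hq (dotProduct_self_eq_zero.1 h)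
  have hpos : 0 < crossProduct (fun i => F.Ω q i 0) (fun i => F.Ω q i 1) ⬝ᵥ
      crossProduct (fun i => F.Ω q i 0) (fun i => F.Ω q i 1) :=
    lt_of_le_of_ne (Finset.sum_nonneg fun i _ => mul_self_nonneg _) hne.symm
  have hd : DifferentiableAt ℝ (fun z => crossProduct (fun i => F.Ω z i 0) (fun i => F.Ω z i 1) ⬝ᵥ
      crossProduct (fun i => F.Ω z i 0) (fun i => F.Ω z i 1)) q := by
    have := differentiableAt_pi.1 hc
    simp only [dotProduct]
    fun_prop
  exact ((hd.sqrt hne).inv (Real.sqrt_ne_zero'.2 hpos)).smul hc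

lemma jac_parallel (hq : q ∈ F.U) (l : ℝ) :
    jac (fun z => F.x z + l • F.n z) q = F.Ω q * (F.Λ q + l • F.μ q)ᵀ := by
  have hx := (F.contDiffAt_x hq).differentiableAt (by simp)
  have hn := F.differentiableAt_n hq
  have h : jac (fun z => F.x z + l • F.n z) q = jac F.x q + l • jac F.n q := by
    ext i j
    have : fderiv ℝ (fun z => F.x z + l • F.n z) q = fderiv ℝ F.x q + l • fderiv ℝ F.n q := by
      rw [← fderiv_const_smul hn l, ← fderiv_add hx (hn.const_smul l)]
      rfl
    simp [jac, this]
  have hn' : jac F.n q = F.Ω q * (F.μ q)ᵀ := F.decomp_n q hq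
  rw [h, F.decomp_x q hq, hn', transpose_add, transpose_smul, Matrix.mul_add, Matrix.mul_smul]

lemma rank_parallel (hq : q ∈ F.U) (l : ℝ) :
    (jac (fun z => F.x z + l • F.n z) q).rank = 2 ↔
      F.lam q - 2 * l * F.HΩ q + l ^ 2 * F.KΩ q ≠ 0 := by
  rw [F.jac_parallel hq, F.rank_base_mul_transpose hq]
  have : (F.Λ q + l • F.μ q).det = F.lam q - 2 * l * F.HΩ q + l ^ 2 * F.KΩ q := by
    simp [lam, HΩ, KΩ, αΩ, det_fin_two, trace_fin_two, adjugate_fin_two, Matrix.mul_apply]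
    ring
  rw [this]

lemma n_dotProduct_jac (hq : q ∈ F.U) (j : Fin 2) :
    ∑ i, F.n q i * fderiv ℝ F.x q (Pi.single j 1) i = 0 := by
  have h : ∀ i, fderiv ℝ F.x q (Pi.single j 1) i = (F.Ω q * (F.Λ q)ᵀ) i j := fun i => by
    rw [← F.decomp_x q hq]; rfl
  simp [h, n, normalOf, Matrix.mul_apply, Fin.sum_univ_three, cross_apply]
  ring

lemma sum_fderiv_n_mul_fderiv_x (hq : q ∈ F.U) (j k : Fin 2) :
    ∑ i, fderiv ℝ F.n q (Pi.single k 1) i * fderiv ℝ F.x q (Pi.single j 1) i =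
      -∑ i, F.n q i * fderiv ℝ (fderiv ℝ F.x) q (Pi.single k 1) (Pi.single j 1) i := by
  have hev : (fun z => ∑ i, F.n z i * fderiv ℝ F.x z (Pi.single j 1) i) =ᶠ[𝓝 q] fun _ => 0 := by
    filter_upwards [F.isOpen_U.mem_nhds hq] with z hz using F.n_dotProduct_jac hz j
  have h0 := hev.fderiv_eq (𝕜 := ℝ)
  have hn := hasFDerivAt_pi'.1 (F.differentiableAt_n hq).hasFDerivAt
  have hx2 : DifferentiableAt ℝ (fderiv ℝ F.x) q :=
    ((F.contDiffAt_x hq).fderiv_right (m := 1)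
      (WithTop.coe_le_coe.2 (le_top : (1 + 1 : ℕ∞) ≤ ⊤))).differentiableAt (by simp)
  have hx1 := hx2.hasFDerivAt.clm_apply (hasFDerivAt_const (Pi.single j 1 : Pt) q)
  have hx := hasFDerivAt_pi'.1 hx1
  have hsum := HasFDerivAt.fun_sum (u := Finset.univ) fun i _ => (hn i).mul (hx i)
  have h1 := hsum.fderiv.symm.trans h0
  have h2 := DFunLike.congr_fun h1 (Pi.single k 1)
  simp [Finset.sum_add_distrib] at h2
  simp only [mul_comm] at h2 ⊢
  linarith

lemma isSymm_IImat (hq : q ∈ F.U) : (F.IImat q)ᵀ = F.IImat q := by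
  have hs : IsSymmSndFDerivAt ℝ F.x q :=
    (F.contDiffAt_x hq).isSymmSndFDerivAt (by
      rw [minSmoothness_of_isRCLikeNormedField]
      exact WithTop.coe_le_coe.2 (le_top : (2 : ℕ∞) ≤ ⊤))
  ext j k
  have h : ∀ a b, F.IImat q a b =
      -∑ i, fderiv ℝ F.n q (Pi.single b 1) i * fderiv ℝ F.x q (Pi.single a 1) i := fun a b => by
    simp [IImat, IIOf, jac, Matrix.mul_apply, mul_comm]
  rw [transpose_apply, h, h, F.sum_fderiv_n_mul_fderiv_x hq, F.sum_fderiv_n_mul_fderiv_x hq,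
    hs.eq]

lemma Imat_eq (hq : q ∈ F.U) : F.Imat q = F.Λ q * ((F.Ω q)ᵀ * F.Ω q) * (F.Λ q)ᵀ := by
  simp only [Imat, IOf, F.decomp_x q hq, transpose_mul, transpose_transpose, Matrix.mul_assoc]

lemma IImat_eq (hq : q ∈ F.U) : F.IImat q = -(F.Λ q * ((F.Ω q)ᵀ * F.Ω q) * (F.μ q)ᵀ) := by
  have hn' : jac F.n q = F.Ω q * (F.μ q)ᵀ := F.decomp_n q hq
  simp only [IImat, IIOf, F.decomp_x q hq, hn', transpose_mul, transpose_transpose,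
    Matrix.mul_assoc]

lemma Kg_eq (hq : q ∈ F.reg) : F.Kg q = F.KΩ q / F.lam q := by
  have hG := (F.det_gram_pos hq.1).ne'
  have hl : (F.Λ q).det ≠ 0 := hq.2
  change (F.IImat q).det / (F.Imat q).det = (F.μ q).det / (F.Λ q).det
  rw [F.IImat_eq hq.1, F.Imat_eq hq.1, det_neg, det_mul, det_mul, det_mul, det_mul,
    det_transpose, det_transpose]
  simp
  field_simp

lemma Wein_eq (hq : q ∈ F.reg) : F.Wein q = F.μ q * (F.Λ q)⁻¹ := by
  have hG : IsUnit (((F.Ω q)ᵀ * F.Ω q).det) := (F.det_gram_pos hq.1).ne'.isUnit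
  have hl : IsUnit (F.Λ q).det := isUnit_iff_ne_zero.2 hq.2
  have hlt : IsUnit ((F.Λ q)ᵀ).det := by rwa [det_transpose]
  have hsymm : ((F.Ω q)ᵀ * F.Ω q)ᵀ = (F.Ω q)ᵀ * F.Ω q := by simp
  change -((F.IImat q)ᵀ * (F.Imat q)⁻¹) = _
  rw [F.IImat_eq hq.1, F.Imat_eq hq.1]
  generalize (F.Ω q)ᵀ * F.Ω q = G at *
  rw [transpose_neg, transpose_mul, transpose_mul, hsymm, transpose_transpose, Matrix.neg_mul,
    neg_neg, Matrix.mul_inv_rev, Matrix.mul_inv_rev, Matrix.mul_assoc, Matrix.mul_assoc,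
    mul_nonsing_inv_cancel_left _ _ hlt, mul_nonsing_inv_cancel_left _ _ hG]

lemma Hm_eq (hq : q ∈ F.reg) : F.Hm q = F.HΩ q / F.lam q := by
  change -(1 / 2) * (F.Wein q).trace = -(1 / 2) * (F.μ q * (F.Λ q).adjugate).trace / (F.Λ q).det
  rw [F.Wein_eq hq, Matrix.inv_def, Matrix.mul_smul, trace_smul, Ring.inverse_eq_inv', smul_eq_mul]
  ring

lemma Kg_le_Hm_sq (hq : q ∈ F.reg) : F.Kg q ≤ F.Hm q ^ 2 := by
  have hl : (F.Λ q).det ≠ 0 := hq.2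
  have hdet : 0 < (F.Imat q).det := by
    rw [F.Imat_eq hq.1, det_mul, det_mul, det_transpose]
    have := F.det_gram_pos hq.1
    have := mul_self_pos.2 hl
    nlinarith [mul_pos ‹0 < ((F.Ω q)ᵀ * F.Ω q).det› this]
  have hsI : F.Imat q 1 0 = F.Imat q 0 1 := by
    simp [Imat, IOf, Matrix.mul_apply, mul_comm]
  have hsII : F.IImat q 1 0 = F.IImat q 0 1 := congrFun₂ (F.isSymm_IImat hq.1) 0 1
  have hd : (F.Imat q).det = F.Imat q 0 0 * F.Imat q 1 1 - F.Imat q 0 1 ^ 2 := by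
    rw [det_fin_two, hsI]; ring
  have hE : 0 < F.Imat q 0 0 := by
    have h0 : 0 ≤ F.Imat q 0 0 := by
      simp only [Imat, IOf, Matrix.mul_apply, transpose_apply]
      exact Finset.sum_nonneg fun i _ => mul_self_nonneg _
    refine lt_of_le_of_ne h0 fun h => ?_
    rw [hd, ← h] at hdet
    nlinarith [sq_nonneg (F.Imat q 0 1)]
  have hK : F.Kg q = (F.IImat q 0 0 * F.IImat q 1 1 - F.IImat q 0 1 ^ 2) / (F.Imat q).det := by
    change (F.IImat q).det / (F.Imat q).det = _
    rw [det_fin_two (F.IImat q), hsII]; ring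
  have hH : F.Hm q = (F.IImat q 0 0 * F.Imat q 1 1 - 2 * F.IImat q 0 1 * F.Imat q 0 1 +
      F.IImat q 1 1 * F.Imat q 0 0) / (2 * (F.Imat q).det) := by
    change -(1 / 2) * (-((F.IImat q)ᵀ * (F.Imat q)⁻¹)).trace = _
    rw [F.isSymm_IImat hq.1, Matrix.inv_def, Matrix.mul_smul, Ring.inverse_eq_inv',
      trace_neg, trace_smul, adjugate_fin_two, trace_fin_two]
    simp [Matrix.mul_apply, hsI, hsII]
    field_simp
    ring
  rw [hK, hH, div_pow, div_le_div_iff₀ hdet (by positivity)]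
  have := sq_nonneg_discriminant (e := F.IImat q 0 0) (f := F.IImat q 0 1) (g := F.IImat q 1 1)
    hE (hd ▸ hdet)
  rw [← hd] at this
  nlinarith

lemma lam_mul_KΩ_le (hq : q ∈ F.U) : F.lam q * F.KΩ q ≤ F.HΩ q ^ 2 := by
  by_cases hl : F.lam q = 0
  · rw [hl, zero_mul]; positivity
  · have h := F.Kg_le_Hm_sq ⟨hq, hl⟩
    rw [F.Kg_eq ⟨hq, hl⟩, F.Hm_eq ⟨hq, hl⟩, div_pow, le_div_iff₀ (by positivity)] at h
    have hcancel : F.KΩ q / F.lam q * F.lam q ^ 2 = F.lam q * F.KΩ q := by field_simp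
    rwa [hcancel] at h

lemma Λ_eq_zero_of_rank (hq : q ∈ F.U) (hr : (jac F.x q).rank = 0) : F.Λ q = 0 := by
  have h0 : jac F.x q = 0 := eq_zero_of_rank_eq_zero hr
  have hG : IsUnit (((F.Ω q)ᵀ * F.Ω q).det) := (F.det_gram_pos hq).ne'.isUnit
  have h1 : ((F.Ω q)ᵀ * F.Ω q) * (F.Λ q)ᵀ = 0 := by
    rw [Matrix.mul_assoc, ← F.decomp_x q hq, h0, Matrix.mul_zero]
  have h2 := nonsing_inv_mul_cancel_left _ (F.Λ q)ᵀ hG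
  rw [h1, Matrix.mul_zero] at h2
  exact transpose_eq_zero.1 h2.symm

lemma KΩ_ne_zero_of_rank (hW : F.IsWavefront) (hq : q ∈ F.U) (hr : (jac F.x q).rank = 0) :
    F.KΩ q ≠ 0 := by
  have h0 : jac F.x q = 0 := by
    rw [F.decomp_x q hq, F.Λ_eq_zero_of_rank hq hr, transpose_zero, Matrix.mul_zero]
  have h := hW q hq
  rw [rank_eq_two_iff_det_gram_ne_zero, transpose_fromRows, fromCols_mul_fromRows, h0,
    Matrix.mul_zero, zero_add, ← rank_eq_two_iff_det_gram_ne_zero] at h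
  have hn' : jac F.n q = F.Ω q * (F.μ q)ᵀ := F.decomp_n q hq
  rwa [hn', F.rank_base_mul_transpose hq] at h

lemma continuousAt_Λ (hq : q ∈ F.U) : ContinuousAt F.Λ q :=
  continuousAt_pi.2 fun i => continuousAt_pi.2 fun j =>
    ((F.smooth_Λ i j).contDiffAt (F.isOpen_U.mem_nhds hq)).continuousAt

lemma continuousAt_μ (hq : q ∈ F.U) : ContinuousAt F.μ q :=
  continuousAt_pi.2 fun i => continuousAt_pi.2 fun j =>
    ((F.smooth_μ i j).contDiffAt (F.isOpen_U.mem_nhds hq)).continuousAt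

lemma continuousAt_lam (hq : q ∈ F.U) : ContinuousAt F.lam q :=
  (continuous_id.matrix_det).continuousAt.comp (F.continuousAt_Λ hq)

lemma continuousAt_KΩ (hq : q ∈ F.U) : ContinuousAt F.KΩ q :=
  (continuous_id.matrix_det).continuousAt.comp (F.continuousAt_μ hq)

lemma continuousAt_HΩ (hq : q ∈ F.U) : ContinuousAt F.HΩ q := by
  have h : Continuous fun A : Matrix (Fin 2) (Fin 2) ℝ × Matrix (Fin 2) (Fin 2) ℝ =>
      -(1 / 2) * (A.1 * A.2.adjugate).trace :=
    continuous_const.mul (continuous_fst.matrix_mul continuous_snd.matrix_adjugate).matrix_trace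
  exact h.continuousAt.comp (f := fun z => (F.μ z, F.Λ z))
    ((F.continuousAt_μ hq).prodMk (F.continuousAt_Λ hq))

end Frontal

lemma tendsto_sub_sqrt_atTop {α : Type*} {l : Filter α} {H K : α → ℝ}
    (hH : Tendsto H l atTop) (hK : ∀ᶠ a in l, 0 < K a)
    (h0 : Tendsto (fun a => H a / K a) l (𝓝 0)) :
    Tendsto (fun a => H a - √(H a ^ 2 - K a)) l atTop := by
  refine tendsto_atTop.2 fun M => ?_
  have hM : 0 < max M 1 := by positivity
  filter_upwards [hK, hH.eventually_ge_atTop (max M 1),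
    h0.eventually (gt_mem_nhds (show (0 : ℝ) < 1 / (2 * max M 1) by positivity))] with a hKa hHa ha
  rw [div_lt_div_iff₀ hKa (by positivity)] at ha
  have hs : √(H a ^ 2 - K a) ≤ H a - max M 1 :=
    Real.sqrt_le_iff.2 ⟨by linarith, by nlinarith⟩
  linarith [le_max_left M 1]

lemma quadratic_root_eq_zero {L H K s : ℝ} (hK : K ≠ 0) (hs : s ^ 2 = H ^ 2 - L * K) :
    L - 2 * ((H + s) / K) * H + ((H + s) / K) ^ 2 * K = 0 := by
  field_simp
  linear_combination hs

namespace Frontal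

variable (F : Frontal) {p : Pt}

lemma eventually_nonneg_of_reg (hP : F.IsProper) (hp : p ∈ F.U) {g : Pt → ℝ}
    (hg : ∀ q ∈ F.U, ContinuousAt g q) (h : ∀ᶠ q in 𝓝[F.reg] p, 0 ≤ g q) :
    ∀ᶠ q in 𝓝 p, 0 ≤ g q := by
  rw [eventually_nhdsWithin_iff] at h
  filter_upwards [h.eventually_nhds, F.isOpen_U.mem_nhds hp] with q hq hqU
  have hcl : q ∈ closure F.reg := by
    rw [mem_closure_iff_nhds]
    intro t ht
    by_contra hne
    have hsub : t ∩ F.U ⊆ F.sing := fun z hz => ⟨hz.2, by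
      by_contra hl
      exact hne ⟨z, hz.1, hz.2, hl⟩⟩
    have hmem : q ∈ interior F.sing :=
      mem_interior_iff_mem_nhds.2 (mem_of_superset (inter_mem ht (F.isOpen_U.mem_nhds hqU)) hsub)
    rw [hP] at hmem
    exact hmem
  have := mem_closure_iff_nhdsWithin_neBot.1 hcl
  exact ge_of_tendsto ((hg q hqU).mono_left nhdsWithin_le_nhds)
    (eventually_nhdsWithin_iff.2 hq)

lemma eventually_mem_U (hp : p ∈ F.U) : ∀ᶠ q in 𝓝 p, q ∈ F.U := F.isOpen_U.mem_nhds hp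

lemma eventually_mem_reg : ∀ᶠ q in 𝓝[F.reg] p, q ∈ F.reg := self_mem_nhdsWithin

lemma HΩ_eq_zero (h : F.Λ p = 0) : F.HΩ p = 0 := by
  simp [HΩ, αΩ, h]

/-- Near `p`, the functions `λ_Ω K_Ω` and `H_Ω K_Ω` have constant sign, the former being
nonnegative. -/
def ConstSignNear (p : Pt) : Prop :=
  (∀ᶠ q in 𝓝 p, 0 ≤ F.lam q * F.KΩ q) ∧
    ((∀ᶠ q in 𝓝 p, 0 ≤ F.HΩ q * F.KΩ q) ∨ ∀ᶠ q in 𝓝 p, F.HΩ q * F.KΩ q ≤ 0)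

variable {F}

lemma tendsto_root (hp : p ∈ F.U) (hl : F.lam p = 0) (hH : F.HΩ p = 0) (hK : F.KΩ p ≠ 0)
    (c : ℝ) :
    Tendsto (fun q => (F.HΩ q + c * √(F.HΩ q ^ 2 - F.lam q * F.KΩ q)) / F.KΩ q) (𝓝 p) (𝓝 0) := by
  have h : ContinuousAt
      (fun q => (F.HΩ q + c * √(F.HΩ q ^ 2 - F.lam q * F.KΩ q)) / F.KΩ q) p :=
    ((F.continuousAt_HΩ hp).add ((((F.continuousAt_HΩ hp).pow 2).sub
      ((F.continuousAt_lam hp).mul (F.continuousAt_KΩ hp))).sqrt.const_mul c)).div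
    (F.continuousAt_KΩ hp) hK
  simpa [ContinuousAt, hl, hH] using h

lemma constSignNear_of_parSmoothable (hp : p ∈ F.U) (hl : F.lam p = 0) (hH : F.HΩ p = 0)
    (hK : F.KΩ p ≠ 0) (h : F.ParSmoothable p) : F.ConstSignNear p := by
  obtain ⟨ε, hε, V, hVo, hpV, hVU, h⟩ := h
  have hsmall : ∀ c : ℝ, ∀ᶠ q in 𝓝 p,
      (F.HΩ q + c * √(F.HΩ q ^ 2 - F.lam q * F.KΩ q)) / F.KΩ q ∈ Set.Ioo (-ε) ε := fun c =>
    (tendsto_root hp hl hH hK c).eventually (Ioo_mem_nhds (by linarith) hε)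
  have hev : ∀ᶠ q in 𝓝 p, q ∈ V ∧ ∃ r₁ ∈ Set.Ioo (-ε) ε, ∃ r₂ ∈ Set.Ioo (-ε) ε,
      F.lam q - 2 * r₁ * F.HΩ q + r₁ ^ 2 * F.KΩ q = 0 ∧
      F.lam q - 2 * r₂ * F.HΩ q + r₂ ^ 2 * F.KΩ q = 0 ∧
      F.lam q * F.KΩ q = r₁ * r₂ * F.KΩ q ^ 2 ∧
      F.HΩ q * F.KΩ q = (r₁ + r₂) / 2 * F.KΩ q ^ 2 := by
    filter_upwards [hVo.mem_nhds hpV, hsmall 1, hsmall (-1),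
      (F.continuousAt_KΩ hp).eventually_ne hK] with q hqV h1 h2 hKq
    have hs := Real.sq_sqrt (sub_nonneg.2 (F.lam_mul_KΩ_le (hVU hqV)))
    refine ⟨hqV, _, h1, _, h2, quadratic_root_eq_zero hKq ?_, quadratic_root_eq_zero hKq ?_, ?_, ?_⟩
    · rw [one_mul, hs]
    · rw [neg_one_mul, neg_sq, hs]
    · field_simp
      linear_combination hs
    · field_simp
      ring
  rcases h with h | h
  · have hle : ∀ q ∈ V, ∀ r ∈ Set.Ioo (-ε) ε,
        F.lam q - 2 * r * F.HΩ q + r ^ 2 * F.KΩ q = 0 → r ≤ 0 := fun q hq r hr h0 => by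
      by_contra! hpos
      exact (F.rank_parallel (hVU hq) r).1 (h q hq r ⟨hpos, hr.2⟩) h0
    refine ⟨?_, Or.inr ?_⟩ <;>
      filter_upwards [hev] with q ⟨hq, r₁, hr₁, r₂, hr₂, e₁, e₂, hLK, hHK⟩
    · rw [hLK]
      exact mul_nonneg (mul_nonneg_of_nonpos_of_nonpos (hle q hq r₁ hr₁ e₁) (hle q hq r₂ hr₂ e₂))
        (sq_nonneg _)
    · rw [hHK]
      exact mul_nonpos_of_nonpos_of_nonneg
        (by linarith [hle q hq r₁ hr₁ e₁, hle q hq r₂ hr₂ e₂]) (sq_nonneg _)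
  · have hle : ∀ q ∈ V, ∀ r ∈ Set.Ioo (-ε) ε,
        F.lam q - 2 * r * F.HΩ q + r ^ 2 * F.KΩ q = 0 → 0 ≤ r := fun q hq r hr h0 => by
      by_contra! hneg
      exact (F.rank_parallel (hVU hq) r).1 (h q hq r ⟨hr.1, hneg⟩) h0
    refine ⟨?_, Or.inl ?_⟩ <;>
      filter_upwards [hev] with q ⟨hq, r₁, hr₁, r₂, hr₂, e₁, e₂, hLK, hHK⟩
    · rw [hLK]
      exact mul_nonneg (mul_nonneg (hle q hq r₁ hr₁ e₁) (hle q hq r₂ hr₂ e₂)) (sq_nonneg _)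
    · rw [hHK]
      exact mul_nonneg (by linarith [hle q hq r₁ hr₁ e₁, hle q hq r₂ hr₂ e₂]) (sq_nonneg _)

lemma parSmoothable_of_constSignNear (hp : p ∈ F.U) (hK : F.KΩ p ≠ 0) (h : F.ConstSignNear p) :
    F.ParSmoothable p := by
  have key : ∀ q l, 0 ≤ F.lam q * F.KΩ q → l * (F.HΩ q * F.KΩ q) ≤ 0 → l ≠ 0 → F.KΩ q ≠ 0 →
      F.lam q - 2 * l * F.HΩ q + l ^ 2 * F.KΩ q ≠ 0 := fun q l h1 h2 hl hKq h0 => by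
    have : 0 < (l * F.KΩ q) ^ 2 := by positivity
    have e : F.lam q * F.KΩ q - 2 * (l * (F.HΩ q * F.KΩ q)) + (l * F.KΩ q) ^ 2 = 0 := by
      linear_combination F.KΩ q * h0
    linarith
  obtain ⟨hLK, hHK⟩ := h
  have hbase := (F.eventually_mem_U hp).and (hLK.and ((F.continuousAt_KΩ hp).eventually_ne hK))
  rcases hHK with hHK | hHK
  · obtain ⟨V, hV, hVo, hpV⟩ := eventually_nhds_iff.1 (hbase.and hHK)
    refine ⟨1, one_pos, V, hVo, hpV, fun q hq => (hV q hq).1.1, Or.inr fun q hq l hl => ?_⟩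
    obtain ⟨⟨hqU, hq1, hq2⟩, hq3⟩ := hV q hq
    exact (F.rank_parallel hqU l).2
      (key q l hq1 (mul_nonpos_of_nonpos_of_nonneg hl.2.le hq3) hl.2.ne hq2)
  · obtain ⟨V, hV, hVo, hpV⟩ := eventually_nhds_iff.1 (hbase.and hHK)
    refine ⟨1, one_pos, V, hVo, hpV, fun q hq => (hV q hq).1.1, Or.inl fun q hq l hl => ?_⟩
    obtain ⟨⟨hqU, hq1, hq2⟩, hq3⟩ := hV q hq
    exact (F.rank_parallel hqU l).2
      (key q l hq1 (mul_nonpos_of_nonneg_of_nonpos hl.1.le hq3) hl.1.ne' hq2)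

lemma exists_noSignChange_iff (hp : p ∈ F.U) (hK : F.KΩ p ≠ 0) :
    (∃ V : Set Pt, IsOpen V ∧ p ∈ V ∧ V ⊆ F.U ∧
      (∀ q ∈ V, 0 ≤ F.lam q * F.KΩ q) ∧ NoSignChange F.HΩ V) ↔ F.ConstSignNear p := by
  have hsign : (∀ᶠ q in 𝓝 p, 0 < F.KΩ q) ∨ ∀ᶠ q in 𝓝 p, F.KΩ q < 0 :=
    hK.lt_or_gt.symm.imp (fun h => (F.continuousAt_KΩ hp).eventually (lt_mem_nhds h))
      (fun h => (F.continuousAt_KΩ hp).eventually (gt_mem_nhds h))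
  constructor
  · rintro ⟨V, hVo, hpV, -, hLK, hH⟩
    have hV := hVo.mem_nhds hpV
    refine ⟨mem_of_superset hV hLK, ?_⟩
    rcases hsign with hs | hs <;> rcases hH with hH | hH
    · left; filter_upwards [hs, hV] with q hq hqV using mul_nonneg (hH q hqV) hq.le
    · right
      filter_upwards [hs, hV] with q hq hqV using mul_nonpos_of_nonpos_of_nonneg (hH q hqV) hq.le
    · right
      filter_upwards [hs, hV] with q hq hqV using mul_nonpos_of_nonneg_of_nonpos (hH q hqV) hq.le
    · left
      filter_upwards [hs, hV] with q hq hqV using mul_nonneg_of_nonpos_of_nonpos (hH q hqV) hq.le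
  · rintro ⟨hLK, hHK⟩
    have hH : (∀ᶠ q in 𝓝 p, 0 ≤ F.HΩ q) ∨ ∀ᶠ q in 𝓝 p, F.HΩ q ≤ 0 := by
      rcases hsign with hs | hs <;> rcases hHK with hHK | hHK
      · left; filter_upwards [hs, hHK] with q hq h using nonneg_of_mul_nonneg_left h hq
      · right; filter_upwards [hs, hHK] with q hq h using nonpos_of_mul_nonpos_left h hq
      · right; filter_upwards [hs, hHK] with q hq h; nlinarith
      · left; filter_upwards [hs, hHK] with q hq h; nlinarith
    have hbase := (F.eventually_mem_U hp).and hLK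
    rcases hH with hH | hH <;> obtain ⟨V, hV, hVo, hpV⟩ := eventually_nhds_iff.1 (hbase.and hH)
    · exact ⟨V, hVo, hpV, fun q hq => (hV q hq).1.1, fun q hq => (hV q hq).1.2,
        Or.inl fun q hq => (hV q hq).2⟩
    · exact ⟨V, hVo, hpV, fun q hq => (hV q hq).1.1, fun q hq => (hV q hq).1.2,
        Or.inr fun q hq => (hV q hq).2⟩

lemma tendsto_curvatures_of_constSignNear (hp : p ∈ F.U) (hl : F.lam p = 0) (hK : F.KΩ p ≠ 0)
    (h : F.ConstSignNear p) :
    Tendsto F.Kg (𝓝[F.reg] p) atTop ∧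
      (Tendsto F.Hm (𝓝[F.reg] p) atTop ∨ Tendsto F.Hm (𝓝[F.reg] p) atBot) := by
  obtain ⟨hLK, hHK⟩ := h
  have hpos : ∀ᶠ q in 𝓝[F.reg] p, 0 < F.lam q * F.KΩ q := by
    filter_upwards [F.eventually_mem_reg, nhdsWithin_le_nhds hLK,
      nhdsWithin_le_nhds ((F.continuousAt_KΩ hp).eventually_ne hK)] with q hq h1 h2
    exact lt_of_le_of_ne h1 (mul_ne_zero hq.2 h2).symm
  have h0 : Tendsto (fun q => F.lam q / F.KΩ q) (𝓝[F.reg] p) (𝓝[>] 0) := by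
    refine tendsto_nhdsWithin_iff.2 ⟨?_, ?_⟩
    · have : Tendsto (fun q => F.lam q / F.KΩ q) (𝓝 p) (𝓝 (F.lam p / F.KΩ p)) :=
        (F.continuousAt_lam hp).div (F.continuousAt_KΩ hp) hK
      rw [hl, zero_div] at this
      exact this.mono_left nhdsWithin_le_nhds
    · filter_upwards [hpos] with q hq
      exact div_pos_iff.2 (mul_pos_iff.1 hq)
  have hKg : Tendsto F.Kg (𝓝[F.reg] p) atTop := by
    refine h0.inv_tendsto_nhdsGT_zero.congr' ?_
    filter_upwards [F.eventually_mem_reg] with q hq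
    simp [F.Kg_eq hq]
  have habs : Tendsto (fun q => |F.Hm q|) (𝓝[F.reg] p) atTop := by
    refine tendsto_atTop_mono' _ ?_ (Real.tendsto_sqrt_atTop.comp hKg)
    filter_upwards [F.eventually_mem_reg] with q hq
    exact (Real.sqrt_le_sqrt (F.Kg_le_Hm_sq hq)).trans_eq (Real.sqrt_sq_eq_abs _)
  have hHm : ∀ᶠ q in 𝓝[F.reg] p,
      0 < F.lam q * F.KΩ q ∧ F.HΩ q * F.KΩ q = F.Hm q * (F.lam q * F.KΩ q) := by
    filter_upwards [F.eventually_mem_reg, hpos] with q hq h1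
    refine ⟨h1, ?_⟩
    have := hq.2
    rw [F.Hm_eq hq]
    field_simp
  refine ⟨hKg, hHK.imp (fun hHK => habs.congr' ?_)
    (fun hHK => (tendsto_neg_atTop_atBot.comp habs).congr' ?_)⟩
  · filter_upwards [hHm, nhdsWithin_le_nhds hHK] with q hq h1
    rw [hq.2] at h1
    exact abs_of_nonneg (nonneg_of_mul_nonneg_left h1 hq.1)
  · filter_upwards [hHm, nhdsWithin_le_nhds hHK] with q hq h1
    rw [hq.2] at h1
    simp [abs_of_nonpos (nonpos_of_mul_nonpos_left h1 hq.1)]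

lemma constSignNear_of_tendsto_curvatures (hP : F.IsProper) (hp : p ∈ F.U)
    (hKg : Tendsto F.Kg (𝓝[F.reg] p) atTop)
    (hHm : Tendsto F.Hm (𝓝[F.reg] p) atTop ∨ Tendsto F.Hm (𝓝[F.reg] p) atBot) :
    F.ConstSignNear p := by
  have hpos : ∀ᶠ q in 𝓝[F.reg] p, 0 ≤ F.lam q * F.KΩ q := by
    filter_upwards [F.eventually_mem_reg, hKg.eventually_gt_atTop 0] with q hq h1
    rw [F.Kg_eq hq] at h1
    rcases div_pos_iff.1 h1 with h | h
    · exact mul_nonneg h.2.le h.1.le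
    · exact mul_nonneg_of_nonpos_of_nonpos h.2.le h.1.le
  have heq : ∀ᶠ q in 𝓝[F.reg] p, F.HΩ q * F.KΩ q = F.Hm q * (F.lam q * F.KΩ q) := by
    filter_upwards [F.eventually_mem_reg] with q hq
    have := hq.2
    rw [F.Hm_eq hq]
    field_simp
  refine ⟨F.eventually_nonneg_of_reg hP hp
    (fun q hq => (F.continuousAt_lam hq).mul (F.continuousAt_KΩ hq)) hpos, ?_⟩
  rcases hHm with hHm | hHm
  · refine Or.inl (F.eventually_nonneg_of_reg hP hp
      (fun q hq => (F.continuousAt_HΩ hq).mul (F.continuousAt_KΩ hq)) ?_)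
    filter_upwards [hpos, heq, hHm.eventually_ge_atTop 0] with q h1 h2 h3
    rw [h2]
    exact mul_nonneg h3 h1
  · have := F.eventually_nonneg_of_reg hP hp (g := fun q => -(F.HΩ q * F.KΩ q))
      (fun q hq => ((F.continuousAt_HΩ hq).mul (F.continuousAt_KΩ hq)).neg) (by
        filter_upwards [hpos, heq, hHm.eventually_le_atBot 0] with q h1 h2 h3
        rw [h2]
        exact neg_nonneg.2 (mul_nonpos_of_nonpos_of_nonneg h3 h1))
    exact Or.inr (this.mono fun q hq => neg_nonneg.1 hq)

lemma tendsto_principal_of_tendsto_κ {l : Filter Pt} {m : Filter ℝ} (hm : Tendsto F.κm l m)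
    (hp : Tendsto F.κp l m) : Tendsto F.k1 l m ∧ Tendsto F.k2 l m :=
  ⟨Tendsto.if' hm hp, Tendsto.if' hp hm⟩

lemma tendsto_principal_of_tendsto_curvatures (hp : p ∈ F.U) (hH : F.HΩ p = 0)
    (hK : F.KΩ p ≠ 0) (hKg : Tendsto F.Kg (𝓝[F.reg] p) atTop)
    (hHm : Tendsto F.Hm (𝓝[F.reg] p) atTop ∨ Tendsto F.Hm (𝓝[F.reg] p) atBot) :
    (Tendsto F.k1 (𝓝[F.reg] p) atTop ∧ Tendsto F.k2 (𝓝[F.reg] p) atTop) ∨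
      (Tendsto F.k1 (𝓝[F.reg] p) atBot ∧ Tendsto F.k2 (𝓝[F.reg] p) atBot) := by
  have h0 : Tendsto (fun q => F.Hm q / F.Kg q) (𝓝[F.reg] p) (𝓝 0) := by
    have h : Tendsto (fun q => F.HΩ q / F.KΩ q) (𝓝 p) (𝓝 (F.HΩ p / F.KΩ p)) :=
      (F.continuousAt_HΩ hp).div (F.continuousAt_KΩ hp) hK
    rw [hH, zero_div] at h
    refine (h.mono_left nhdsWithin_le_nhds).congr' ?_
    filter_upwards [F.eventually_mem_reg] with q hq
    rw [F.Hm_eq hq, F.Kg_eq hq, div_div_div_cancel_right₀ hq.2]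
  have hpos := hKg.eventually_gt_atTop 0
  refine hHm.imp (fun hHm => tendsto_principal_of_tendsto_κ ?_ ?_)
    (fun hHm => tendsto_principal_of_tendsto_κ ?_ ?_)
  · exact tendsto_sub_sqrt_atTop hHm hpos h0
  · exact tendsto_atTop_mono (fun q => le_add_of_nonneg_right (Real.sqrt_nonneg _)) hHm
  · exact tendsto_atBot_mono (fun q => sub_le_self _ (Real.sqrt_nonneg _)) hHm
  · have h := tendsto_sub_sqrt_atTop (tendsto_neg_atBot_atTop.comp hHm) hpos (by
      simpa [neg_div] using h0.neg)
    refine (tendsto_neg_atTop_atBot.comp h).congr fun q => ?_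
    simp [κp]
    ring

lemma k1_mul_k2 {q : Pt} (hq : q ∈ F.reg) : F.k1 q * F.k2 q = F.Kg q := by
  have hs := Real.sq_sqrt (sub_nonneg.2 (F.Kg_le_Hm_sq hq))
  unfold k1 k2 κm κp
  split_ifs <;> linear_combination -hs

lemma k1_add_k2 (q : Pt) : (F.k1 q + F.k2 q) / 2 = F.Hm q := by
  unfold k1 k2 κm κp
  split_ifs <;> ring

lemma tendsto_curvatures_of_tendsto_principal
    (h : (Tendsto F.k1 (𝓝[F.reg] p) atTop ∧ Tendsto F.k2 (𝓝[F.reg] p) atTop) ∨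
      (Tendsto F.k1 (𝓝[F.reg] p) atBot ∧ Tendsto F.k2 (𝓝[F.reg] p) atBot)) :
    Tendsto F.Kg (𝓝[F.reg] p) atTop ∧
      (Tendsto F.Hm (𝓝[F.reg] p) atTop ∨ Tendsto F.Hm (𝓝[F.reg] p) atBot) := by
  have hmul : (fun q => F.k1 q * F.k2 q) =ᶠ[𝓝[F.reg] p] F.Kg :=
    F.eventually_mem_reg.mono fun q hq => k1_mul_k2 hq
  rcases h with ⟨h1, h2⟩ | ⟨h1, h2⟩
  · exact ⟨(h1.atTop_mul_atTop₀ h2).congr' hmul,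
      Or.inl (((h1.atTop_add_atTop h2).atTop_div_const two_pos).congr k1_add_k2)⟩
  · exact ⟨(h1.atBot_mul_atBot₀ h2).congr' hmul,
      Or.inr (((h1.atBot_add_atBot h2).atBot_div_const two_pos).congr k1_add_k2)⟩

end Frontal

/-- at a rank-0 singularity of a proper wavefront, parallel
smoothability is equivalent to: `λ_Ω K_Ω ≥ 0` with `H_Ω` of constant sign near
`p`; to `K → +∞` with `H → ±∞`; and to `k₁, k₂ → +∞` jointly or `k₁, k₂ → −∞`
jointly through the regular set. -/
theorem stmt19 (F : Frontal) (hW : F.IsWavefront) (hP : F.IsProper)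
    (p : Pt) (hp : p ∈ F.sing) (hr : (jac F.x p).rank = 0) :
    List.TFAE [
      F.ParSmoothable p,
      ∃ V : Set Pt, IsOpen V ∧ p ∈ V ∧ V ⊆ F.U ∧
        (∀ q ∈ V, 0 ≤ F.lam q * F.KΩ q) ∧ NoSignChange F.HΩ V,
      Tendsto F.Kg (nhdsWithin p F.reg) atTop ∧
        (Tendsto F.Hm (nhdsWithin p F.reg) atTop ∨
         Tendsto F.Hm (nhdsWithin p F.reg) atBot),
      (Tendsto F.k1 (nhdsWithin p F.reg) atTop ∧
        Tendsto F.k2 (nhdsWithin p F.reg) atTop) ∨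
      (Tendsto F.k1 (nhdsWithin p F.reg) atBot ∧
        Tendsto F.k2 (nhdsWithin p F.reg) atBot)] := by
  have hU := hp.1
  have hΛ := F.Λ_eq_zero_of_rank hU hr
  have hH := F.HΩ_eq_zero hΛ
  have hK := F.KΩ_ne_zero_of_rank hW hU hr
  tfae_have 1 → 2 := fun h => (Frontal.exists_noSignChange_iff hU hK).2
    (Frontal.constSignNear_of_parSmoothable hU hp.2 hH hK h)
  tfae_have 2 → 1 := fun h => Frontal.parSmoothable_of_constSignNear hU hK
    ((Frontal.exists_noSignChange_iff hU hK).1 h)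
  tfae_have 2 → 3 := fun h => Frontal.tendsto_curvatures_of_constSignNear hU hp.2 hK
    ((Frontal.exists_noSignChange_iff hU hK).1 h)
  tfae_have 3 → 2 := fun h => (Frontal.exists_noSignChange_iff hU hK).2
    (Frontal.constSignNear_of_tendsto_curvatures hP hU h.1 h.2)
  tfae_have 3 → 4 := fun h => Frontal.tendsto_principal_of_tendsto_curvatures hU hH hK h.1 h.2
  tfae_have 4 → 3 := Frontal.tendsto_curvatures_of_tendsto_principal
  tfae_finish
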